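/- Let A be a commutative ℚ-algebra and φ : A((t)) → A((t)) a continuous A-algebra automorphism. Then for any g, f ∈ A((t)) with 1+g a unit such that g^i → 0 (so log(1+g) is defined) and f ∈ A((t))*, one has exp res(log(φ(1+g)) · d(φ(f))/φ(f)) = exp res(log(1+g) · df/f) in A*; i.e., the explicit one-dimensional Contou-Carrère symbol CC₁(1+g, f) is invariant under continuous A-algebra automorphisms. -/

import Mathlib

/-- The formal derivative `d/dt` of a Laurent series. -/
noncomputable def lderiv {A : Type*} [CommRing A] (f : LaurentSeries A) : LaurentSeries A where
  coeff l := (l + 1) • f.coeff (l + 1)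
  isPWO_support' := by
    refine Set.IsPWO.mono ((f.isPWO_support.image_of_monotone
      (f := fun l : ℤ => l - 1) (fun a b h => by simpa using h))) ?_
    intro l hl
    have h1 : f.coeff (l + 1) ≠ 0 := by
      intro h; simp [Function.mem_support, h] at hl
    exact ⟨l + 1, h1, by ring⟩

/-- A sequence of Laurent series tends to `0` in the `t`-adic (Laurent series) topology. -/
def LSTendsToZero {A : Type*} [CommRing A] (s : ℕ → LaurentSeries A) : Prop :=
  ∀ N : ℤ, ∃ I : ℕ, ∀ i ≥ I, ∀ l < N, (s i).coeff l = 0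

/-- Convergence of the series `Σ F i` to `S` in the Laurent series topology. -/
def SeriesConvTo {A : Type*} [CommRing A] (F : ℕ → LaurentSeries A) (S : LaurentSeries A) :
    Prop :=
  ∀ N : ℤ, ∃ I : ℕ, ∀ m ≥ I, ∀ l < N, (S - ∑ i ∈ Finset.range m, F i).coeff l = 0

/-- The `i`-th term `(−1)^{i+1} g^i / i` of the series `log(1+g)` (zero for `i = 0`). -/
noncomputable def logTerm {A : Type*} [CommRing A] [Algebra ℚ A]
    (g : LaurentSeries A) (i : ℕ) : LaurentSeries A :=
  ((-1 : ℚ) ^ (i + 1) / i) • g ^ i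

/-- `E` is the value of the exponential series `Σ a^i / i!` at `a` (the partial sums are
eventually constant, as happens for nilpotent `a`). -/
def ExpEq {B : Type*} [CommRing B] [Algebra ℚ B] (a E : B) : Prop :=
  ∃ N : ℕ, ∀ m ≥ N, ∑ i ∈ Finset.range m, ((1 : ℚ) / i.factorial) • a ^ i = E

namespace ContouCarrere

open HahnSeries

section Basic

variable {A : Type*} [CommRing A]

theorem coeff_lderiv (f : LaurentSeries A) (l : ℤ) :
    (lderiv f).coeff l = (l + 1) • f.coeff (l + 1) := rfl

theorem coeff_neg_one_lderiv (f : LaurentSeries A) : (lderiv f).coeff (-1) = 0 := by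
  simp [coeff_lderiv]

theorem lderiv_add (f g : LaurentSeries A) : lderiv (f + g) = lderiv f + lderiv g := by
  ext l; simp [coeff_lderiv]

theorem lderiv_C_mul (a : A) (f : LaurentSeries A) : lderiv (C a * f) = C a * lderiv f := by
  ext l; simp [coeff_lderiv, mul_left_comm]

theorem lderiv_one : lderiv (1 : LaurentSeries A) = 0 := by
  ext l
  by_cases h : l + 1 = 0 <;> simp [coeff_lderiv, coeff_one, h]

theorem lderiv_single (i : ℤ) (a : A) : lderiv (single i a) = single (i - 1) (i • a) := by
  ext l
  by_cases h : l = i - 1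
  · subst h; simp [coeff_lderiv]
  · rw [coeff_lderiv, coeff_single_of_ne (by omega), coeff_single_of_ne h, smul_zero]

/-- The Euler operator `t * d/dt`. -/
noncomputable def euler (f : LaurentSeries A) : LaurentSeries A where
  coeff l := l • f.coeff l
  isPWO_support' := f.isPWO_support.mono fun l hl h => hl (by simp [h])

theorem coeff_euler (f : LaurentSeries A) (l : ℤ) : (euler f).coeff l = l • f.coeff l := rfl

theorem support_euler_subset (f : LaurentSeries A) : (euler f).support ⊆ f.support :=
  fun l hl h => hl (by simp [coeff_euler, h])

theorem euler_mul (f g : LaurentSeries A) : euler (f * g) = euler f * g + f * euler g := by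
  ext l
  rw [coeff_add, coeff_mul_left' f.isPWO_support (support_euler_subset f),
    coeff_mul_right' g.isPWO_support (support_euler_subset g), coeff_euler, coeff_mul,
    Finset.smul_sum, ← Finset.sum_add_distrib]
  refine Finset.sum_congr rfl fun ij hij => ?_
  have h : ij.1 + ij.2 = l := by simp at hij; tauto
  simp only [coeff_euler, ← h, zsmul_eq_mul]
  push_cast
  ring

theorem lderiv_eq_single_mul_euler (f : LaurentSeries A) : lderiv f = single (-1) 1 * euler f := by
  ext l
  rw [show l = (l + 1) + (-1) by ring, coeff_single_mul_add, coeff_lderiv, coeff_euler]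
  simp

theorem lderiv_mul (f g : LaurentSeries A) : lderiv (f * g) = lderiv f * g + f * lderiv g := by
  simp only [lderiv_eq_single_mul_euler, euler_mul]
  ring

theorem lderiv_pow_succ (f : LaurentSeries A) (n : ℕ) :
    lderiv (f ^ (n + 1)) = (n + 1 : ℕ) • (f ^ n * lderiv f) := by
  induction n with
  | zero => simp
  | succ n ih =>
    rw [pow_succ, lderiv_mul, ih]
    simp only [nsmul_eq_mul]
    push_cast
    ring

theorem exists_coeff_eq_zero_of_lt (f : LaurentSeries A) : ∃ M : ℤ, ∀ l < M, f.coeff l = 0 :=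
  ⟨f.order, fun _ hl => coeff_eq_zero_of_lt_order hl⟩

theorem coeff_mul_eq_zero_of_lt {f g : LaurentSeries A} {a b l : ℤ}
    (hf : ∀ i < a, f.coeff i = 0) (hg : ∀ j < b, g.coeff j = 0) (hl : l < a + b) :
    (f * g).coeff l = 0 := by
  rw [coeff_mul]
  refine Finset.sum_eq_zero fun ij hij => ?_
  have h : ij.1 + ij.2 = l := by simp at hij; tauto
  rcases lt_or_ge ij.1 a with h1 | h1
  · rw [hf _ h1, zero_mul]
  · rw [hg _ (by omega), mul_zero]

theorem _root_.LSTendsToZero.mul_right {s : ℕ → LaurentSeries A} (hs : LSTendsToZero s)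
    (g : LaurentSeries A) : LSTendsToZero fun i => s i * g := by
  obtain ⟨M, hM⟩ := exists_coeff_eq_zero_of_lt g
  intro N
  obtain ⟨I, hI⟩ := hs (N - M)
  exact ⟨I, fun i hi l hl => coeff_mul_eq_zero_of_lt (hI i hi) hM (by omega)⟩

theorem _root_.LSTendsToZero.lderiv {s : ℕ → LaurentSeries A} (hs : LSTendsToZero s) :
    LSTendsToZero fun i => lderiv (s i) := by
  intro N
  obtain ⟨I, hI⟩ := hs (N + 1)
  exact ⟨I, fun i hi l hl => by rw [coeff_lderiv, hI i hi _ (by omega), smul_zero]⟩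

theorem _root_.LSTendsToZero.exists_coeff_eq_zero {s : ℕ → LaurentSeries A}
    (hs : LSTendsToZero s) (l : ℤ) : ∃ I, ∀ i ≥ I, (s i).coeff l = 0 := by
  obtain ⟨I, hI⟩ := hs (l + 1)
  exact ⟨I, fun i hi => hI i hi l (by omega)⟩

theorem lsTendsToZero_single : LSTendsToZero fun i : ℕ => (single (i : ℤ) (1 : A)) :=
  fun N => ⟨N.toNat, fun i hi l hl => coeff_single_of_ne (by omega)⟩

theorem seriesConvTo_unique {F : ℕ → LaurentSeries A} {S T : LaurentSeries A}
    (hS : SeriesConvTo F S) (hT : SeriesConvTo F T) : S = T := by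
  ext l
  obtain ⟨I, hI⟩ := hS (l + 1)
  obtain ⟨J, hJ⟩ := hT (l + 1)
  have h1 := hI (max I J) (le_max_left _ _) l (by omega)
  have h2 := hJ (max I J) (le_max_right _ _) l (by omega)
  rw [coeff_sub, sub_eq_zero] at h1 h2
  exact h1.trans h2.symm

/-- An additive map which annihilates a late term of every null sequence annihilates a series
as soon as it annihilates its monomials. -/
theorem map_eq_zero_of_single {B : Type*} [AddCommGroup B] (γ : LaurentSeries A →+ B)
    (hγ : ∀ s : ℕ → LaurentSeries A, LSTendsToZero s → ∃ i, γ (s i) = 0)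
    (h : LaurentSeries A) (hh : ∀ i, γ (single i (h.coeff i)) = 0) : γ h = 0 := by
  obtain ⟨M, hM⟩ := exists_coeff_eq_zero_of_lt h
  obtain ⟨m, hm⟩ := hγ
    (fun m => h - ∑ i ∈ Finset.range m, single (M + i) (h.coeff (M + i))) <| by
      refine fun N => ⟨(N - M).toNat, fun m hm l hl => ?_⟩
      simp only [coeff_sub, coeff_sum, coeff_single]
      rcases lt_or_ge l M with hlM | hlM
      · rw [hM l hlM, Finset.sum_eq_zero, sub_zero]
        intro i _
        rw [if_neg (by omega)]
      · rw [Finset.sum_eq_single (l - M).toNat, if_pos (by omega), sub_eq_zero]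
        · congr 1; omega
        · intro i _ hi
          rw [if_neg (by omega)]
        · intro hi
          simp only [Finset.mem_range] at hi
          omega
  rw [map_sub, map_sum, Finset.sum_eq_zero fun i _ => hh _, sub_zero] at hm
  exact hm

theorem map_mul {B : Type*} [CommRing B] (ρ : A →+* B) (f g : LaurentSeries A) :
    (f * g).map ρ = f.map ρ * g.map ρ :=
  HahnSeries.map_mul (ρ : A →ₙ+* B)

theorem isNilpotent_of_coeff {f : LaurentSeries A} {M N : ℤ} (hM : ∀ l < M, f.coeff l = 0)
    (hN : ∀ l ≥ N, f.coeff l = 0) (hnil : ∀ l, IsNilpotent (f.coeff l)) : IsNilpotent f := by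
  have h : f = ∑ i ∈ Finset.Ico M N, C (f.coeff i) * single i 1 := by
    ext l
    simp only [coeff_sum, C_mul_eq_smul, coeff_smul, coeff_single, smul_eq_mul, mul_ite, mul_one,
      mul_zero, Finset.sum_ite_eq, Finset.mem_Ico]
    split_ifs with hl
    · rfl
    · rcases lt_or_ge l M with h1 | h1
      · exact hM l h1
      · exact hN l (by omega)
  rw [h]
  exact isNilpotent_sum fun i _ => (Commute.all _ _).isNilpotent_mul_right ((hnil i).map C)

theorem coeff_ofPowerSeries_of_neg (U : PowerSeries A) {l : ℤ} (hl : l < 0) :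
    (ofPowerSeries ℤ A U).coeff l = 0 := by
  rw [PowerSeries.coeff_coe, if_pos hl]

theorem coeff_neg_one_lderiv_ofPowerSeries_mul (U V : PowerSeries A) :
    (lderiv (ofPowerSeries ℤ A U) * ofPowerSeries ℤ A V).coeff (-1) = 0 := by
  refine coeff_mul_eq_zero_of_lt (a := 0) (b := 0) (fun l hl => ?_)
    (fun l hl => coeff_ofPowerSeries_of_neg V hl) (by norm_num)
  rcases eq_or_ne (l + 1) 0 with h | h
  · rw [coeff_lderiv, h, zero_smul]
  · rw [coeff_lderiv, coeff_ofPowerSeries_of_neg U (by omega), smul_zero]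

theorem coeff_neg_one_pow_mul_lderiv [Algebra ℚ A] (f : LaurentSeries A) (n : ℕ) :
    (f ^ n * lderiv f).coeff (-1) = 0 := by
  have : IsAddTorsionFree A := IsAddTorsionFree.of_module_rat A
  have h := coeff_neg_one_lderiv (f ^ (n + 1))
  rw [lderiv_pow_succ, coeff_smul] at h
  exact (smul_eq_zero.1 h).resolve_left n.succ_ne_zero

/-- The logarithmic derivative of a series with invertible linear coefficient and nilpotent
coefficients in degrees `≤ 0` has residue `1`. -/
theorem coeff_neg_one_lderiv_mul_inv [Algebra ℚ A] {x y : LaurentSeries A} (hxy : x * y = 1)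
    (hnil : ∀ i < 1, IsNilpotent (x.coeff i)) (hunit : IsUnit (x.coeff 1)) :
    (lderiv x * y).coeff (-1) = 1 := by
  set P : PowerSeries A := PowerSeries.mk fun n => x.coeff (n + 1) with hP
  obtain ⟨Q, hPQ⟩ : ∃ Q, P * Q = 1 := by
    refine IsUnit.exists_right_inv (PowerSeries.isUnit_iff_constantCoeff.2 ?_)
    simpa [hP] using hunit
  set T : LaurentSeries A := single 1 1 with hT
  set T' : LaurentSeries A := single (-1) 1 with hT'
  set U : LaurentSeries A := ofPowerSeries ℤ A P with hU
  set V : LaurentSeries A := ofPowerSeries ℤ A Q with hV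
  have hTT : T * T' = 1 := by rw [hT, hT', single_mul_single]; simp
  have hUV : U * V = 1 := by rw [hU, hV, ← _root_.map_mul, hPQ, map_one]
  have hcoeff : ∀ l, (x - T * U).coeff l = if l < 1 then x.coeff l else 0 := fun l => by
    have h : (T * U).coeff l = U.coeff (l - 1) := by
      conv_lhs => rw [← sub_add_cancel l 1, hT, coeff_single_mul_add, one_mul]
    rw [coeff_sub, h, hU, PowerSeries.coeff_coe]
    split_ifs with h1 h2 h2
    · rw [sub_zero]
    · omega
    · omega
    · rw [hP, PowerSeries.coeff_mk, sub_eq_zero]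
      congr 1; omega
  have hw : IsNilpotent (x - T * U) := by
    obtain ⟨M, hM⟩ := exists_coeff_eq_zero_of_lt x
    refine isNilpotent_of_coeff (M := M) (N := 1) (fun l hl => ?_) (fun l hl => ?_) fun l => ?_
    · rw [hcoeff, hM l hl, ite_self]
    · rw [hcoeff, if_neg (by omega)]
    · rw [hcoeff]
      split_ifs with h
      · exact hnil l h
      · exact IsNilpotent.zero
  obtain ⟨ν, hν⟩ : ∃ ν, ν = (x - T * U) * (T' * V) := ⟨_, rfl⟩
  obtain ⟨k, hk⟩ : IsNilpotent ν := hν ▸ (Commute.all _ _).isNilpotent_mul_right hw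
  obtain ⟨s, hs⟩ : ∃ s, s = ∑ j ∈ Finset.range k, (-ν) ^ j := ⟨_, rfl⟩
  have hνs : (1 + ν) * s = 1 := by
    have h := mul_neg_geom_sum (-ν) k
    rwa [neg_pow, hk, mul_zero, sub_zero, sub_neg_eq_add, ← hs] at h
  have hx : x = T * U * (1 + ν) := by
    rw [hν]
    linear_combination (T * U - x) * hTT + (T * U - x) * T * T' * hUV
  have hy : y = T' * V * s := by
    rw [hx] at hxy
    linear_combination T' * V * s * hxy - y * hTT - y * T * T' * hUV - y * T * T' * U * V * hνs
  have hDT : lderiv T = 1 := by rw [hT, lderiv_single]; simp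
  have hlog : lderiv x * y = T' + lderiv U * V + lderiv ν * s := by
    rw [hy, hx, lderiv_mul, lderiv_mul, lderiv_add, lderiv_one, hDT]
    linear_combination (lderiv U * V * (1 + ν) * s + U * V * lderiv ν * s) * hTT +
      (T' * (1 + ν) * s + lderiv ν * s) * hUV + (T' + lderiv U * V) * hνs
  have hres : (lderiv ν * s).coeff (-1) = 0 := by
    rw [hs, Finset.mul_sum, coeff_sum]
    refine Finset.sum_eq_zero fun j _ => ?_
    rw [neg_pow, show lderiv ν * ((-1) ^ j * ν ^ j) = (-1 : ℤ) ^ j • (ν ^ j * lderiv ν) by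
      rw [zsmul_eq_mul]; push_cast; ring, coeff_smul, coeff_neg_one_pow_mul_lderiv, smul_zero]
  rw [hlog, coeff_add, coeff_add, hres, coeff_neg_one_lderiv_ofPowerSeries_mul, hT']
  simp

end Basic

section Automorphism

variable {A : Type*} [CommRing A] {φ : LaurentSeries A →ₐ[A] LaurentSeries A}

theorem map_C (φ : LaurentSeries A →ₐ[A] LaurentSeries A) (a : A) : φ (C a) = C a := by
  have h : algebraMap A (LaurentSeries A) a = C a := by
    rw [algebraMap_apply']
    simp
  rw [← h, φ.commutes]

theorem map_single (φ : LaurentSeries A →ₐ[A] LaurentSeries A) (i : ℤ) (a : A) :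
    φ (single i a) = C a * φ (single i 1) := by
  rw [← map_C φ, ← _root_.map_mul, C_mul_eq_smul]
  congr 1
  ext l
  simp [coeff_single]

theorem map_single_add (φ : LaurentSeries A →ₐ[A] LaurentSeries A) (i j : ℤ) :
    φ (single (i + j) 1) = φ (single i 1) * φ (single j 1) := by
  rw [← _root_.map_mul, single_mul_single, one_mul]

theorem map_single_zero (φ : LaurentSeries A →ₐ[A] LaurentSeries A) :
    φ (single 0 1) = 1 := map_one φ

theorem lderiv_map_single (φ : LaurentSeries A →ₐ[A] LaurentSeries A) (i : ℤ) :
    lderiv (φ (single i 1)) = i • (φ (single (i - 1) 1) * lderiv (φ (single 1 1))) := by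
  induction i with
  | zero => rw [map_single_zero, lderiv_one, zero_smul]
  | succ i ih =>
    have e := map_single_add φ (i - 1) 1
    rw [sub_add_cancel] at e
    rw [map_single_add, lderiv_mul, ih, add_sub_cancel_right, e]
    simp only [zsmul_eq_mul]
    push_cast
    ring
  | pred i ih =>
    have h0 := map_single_add φ 1 (-1)
    rw [add_neg_cancel, map_single_zero] at h0
    have h1 := congrArg lderiv h0
    rw [lderiv_one, lderiv_mul] at h1
    have e := map_single_add φ (-i - 1) (-1)
    rw [sub_eq_add_neg (-(i : ℤ)) 1, map_single_add, lderiv_mul, ih, ← sub_eq_add_neg,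
      sub_eq_add_neg (-(i : ℤ) - 1) 1, e, sub_eq_add_neg (-(i : ℤ)) 1, map_single_add]
    simp only [zsmul_eq_mul]
    push_cast
    linear_combination -(φ (single (-(i : ℤ)) 1)) * φ (single (-1) 1) * h1 +
      φ (single (-(i : ℤ)) 1) * lderiv (φ (single (-1) 1)) * h0

/-- The chain rule for a continuous endomorphism. -/
theorem lderiv_map
    (hcont : ∀ s : ℕ → LaurentSeries A, LSTendsToZero s → LSTendsToZero (fun i => φ (s i)))
    (f : LaurentSeries A) :
    lderiv (φ f) = φ (lderiv f) * lderiv (φ (single 1 1)) := by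
  ext l
  rw [← sub_eq_zero]
  refine map_eq_zero_of_single
    (AddMonoidHom.mk' (fun f => (lderiv (φ f)).coeff l -
      (φ (lderiv f) * lderiv (φ (single 1 1))).coeff l) fun f g => ?_) (fun s hs => ?_) f
      fun i => ?_
  · simp only [map_add, lderiv_add, add_mul, coeff_add]; ring
  · obtain ⟨I, hI⟩ := (hcont s hs).lderiv.exists_coeff_eq_zero l
    obtain ⟨J, hJ⟩ := ((hcont _ hs.lderiv).mul_right
      (lderiv (φ (single 1 1)))).exists_coeff_eq_zero l
    exact ⟨max I J, by simp [hI _ (le_max_left I J), hJ _ (le_max_right I J)]⟩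
  · rw [AddMonoidHom.mk'_apply, sub_eq_zero, lderiv_single, map_single, map_single φ (i - 1),
      lderiv_C_mul, lderiv_map_single, map_zsmul, zsmul_eq_mul, zsmul_eq_mul]
    congr 1
    ring

theorem coeff_map_single_one
    (hcont : ∀ s : ℕ → LaurentSeries A, LSTendsToZero s → LSTendsToZero (fun i => φ (s i)))
    (hsurj : Function.Surjective φ) {B : Type*} [CommRing B]
    [IsDomain B] (ρ : A →+* B) :
    (∀ i < 1, ρ ((φ (single 1 1)).coeff i) = 0) ∧ ρ ((φ (single 1 1)).coeff 1) ≠ 0 := by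
  have hne : ∀ i, (φ (single i 1)).map ρ ≠ 0 := fun i hi => by
    have h := map_mul ρ (φ (single i 1)) (φ (single (-i) 1))
    rw [← map_single_add, add_neg_cancel, map_single_zero, hi, zero_mul] at h
    simpa [HahnSeries.map] using congrArg (fun f => f.coeff 0) h
  let e : ℤ →+ ℤ := AddMonoidHom.mk' (fun i => ((φ (single i 1)).map ρ).order) fun i j => by
    rw [map_single_add, map_mul, order_mul (hne i) (hne j)]
  have he : ∀ i, ((φ (single i 1)).map ρ).order = i * e 1 := fun i => by
    change e i = _
    conv_lhs => rw [← mul_one i, ← smul_eq_mul, map_zsmul, smul_eq_mul]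
  have hpos : 0 < e 1 := by
    obtain ⟨I, hI⟩ := hcont _ lsTendsToZero_single 1
    have h : ¬ ((φ (single (I : ℤ) 1)).map ρ).order < 1 := fun hlt =>
      coeff_order_eq_zero.not.2 (hne I) (by
        change ρ _ = 0
        rw [hI I le_rfl _ hlt, map_zero])
    rw [he, not_lt] at h
    by_contra! h0
    nlinarith [Int.natCast_nonneg I]
  have hγ : ∀ (l : ℤ) (h : LaurentSeries A),
      (∀ i, ρ (h.coeff i) = 0 ∨ l < i * e 1) → ρ ((φ h).coeff l) = 0 := fun l h hh => by
    refine map_eq_zero_of_single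
      (AddMonoidHom.mk' (fun h => ρ ((φ h).coeff l)) fun f g => by simp) (fun s hs => ?_) h
      fun i => ?_
    · obtain ⟨I, hI⟩ := (hcont s hs).exists_coeff_eq_zero l
      exact ⟨I, by simp [hI I le_rfl]⟩
    · rw [AddMonoidHom.mk'_apply, map_single, C_mul_eq_smul, coeff_smul, smul_eq_mul, _root_.map_mul]
      rcases hh i with h0 | h0
      · rw [h0, zero_mul]
      · rw [← he] at h0
        rw [show ρ ((φ (single i 1)).coeff l) = 0 from coeff_eq_zero_of_lt_order h0, mul_zero]
  obtain ⟨h, hh⟩ := hsurj (single 1 1)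
  have hh0 : h.map ρ ≠ 0 := fun h0 => by
    have := hγ 1 h fun i => Or.inl (congrArg (fun f => f.coeff i) h0)
    simp [hh] at this
  set m := (h.map ρ).order with hm
  have hm0 : ρ (h.coeff m) ≠ 0 := coeff_order_eq_zero.not.2 hh0
  have key : ρ ((φ h).coeff (m * e 1)) ≠ 0 := by
    have h1 := hγ (m * e 1) (h - single m (h.coeff m)) fun i => by
      rcases lt_trichotomy i m with hi | rfl | hi
      · left
        rw [coeff_sub, coeff_single_of_ne hi.ne, sub_zero]
        exact coeff_eq_zero_of_lt_order hi
      · left; simp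
      · right; exact mul_lt_mul_of_pos_right hi hpos
    rw [map_sub, coeff_sub, map_sub, sub_eq_zero] at h1
    rw [h1, map_single, C_mul_eq_smul, coeff_smul, smul_eq_mul, _root_.map_mul, ← he]
    exact mul_ne_zero hm0 (coeff_order_eq_zero.not.2 (hne m))
  have h1 : m * e 1 = 1 := by
    by_contra hne1
    rw [hh, coeff_single_of_ne hne1, map_zero] at key
    exact key rfl
  have h2 : e 1 = 1 := Int.eq_one_of_mul_eq_one_left hpos.le h1
  have h3 : ((φ (single 1 1)).map ρ).order = 1 := h2
  refine ⟨fun i hi => ?_, ?_⟩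
  · rw [← h3] at hi
    exact coeff_eq_zero_of_lt_order hi
  · have := coeff_order_eq_zero.not.2 (hne 1)
    rwa [h3] at this

/-- Continuous automorphisms preserve the residue of differential forms. -/
theorem coeff_neg_one_map_mul_lderiv [Algebra ℚ A]
    (hcont : ∀ s : ℕ → LaurentSeries A, LSTendsToZero s → LSTendsToZero (fun i => φ (s i)))
    (hsurj : Function.Surjective φ)
    (h : LaurentSeries A) :
    (φ h * lderiv (φ (single 1 1))).coeff (-1) = h.coeff (-1) := by
  rw [← sub_eq_zero]
  refine map_eq_zero_of_single
    (AddMonoidHom.mk' (fun h => (φ h * lderiv (φ (single 1 1))).coeff (-1) - h.coeff (-1))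
      fun f g => ?_) (fun s hs => ?_) h fun i => ?_
  · simp only [map_add, add_mul, coeff_add]; ring
  · obtain ⟨I, hI⟩ := ((hcont _ hs).mul_right
      (lderiv (φ (single 1 1)))).exists_coeff_eq_zero (-1)
    obtain ⟨J, hJ⟩ := hs.exists_coeff_eq_zero (-1)
    exact ⟨max I J, by simp [hI _ (le_max_left I J), hJ _ (le_max_right I J)]⟩
  · rw [AddMonoidHom.mk'_apply, sub_eq_zero, map_single, mul_assoc, C_mul_eq_smul,
      coeff_smul]
    by_cases hi : i = -1
    · subst hi
      rw [mul_comm, coeff_neg_one_lderiv_mul_inv (x := φ (single 1 1))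
        (by rw [← map_single_add, add_neg_cancel, map_single_zero])]
      · simp
      · intro i hi
        refine nilpotent_iff_mem_prime.2 fun J hJ => ?_
        exact Ideal.Quotient.eq_zero_iff_mem.1
          ((coeff_map_single_one hcont hsurj (Ideal.Quotient.mk J)).1 i hi)
      · by_contra hu
        obtain ⟨J, hJ, hmem⟩ := exists_max_ideal_of_mem_nonunits hu
        exact (coeff_map_single_one hcont hsurj (Ideal.Quotient.mk J)).2
          (Ideal.Quotient.eq_zero_iff_mem.2 hmem)
    · have h1 := coeff_neg_one_lderiv (φ (single (i + 1) 1))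
      rw [lderiv_map_single, add_sub_cancel_right, coeff_smul] at h1
      have h2 : (φ (single i 1) * lderiv (φ (single 1 1))).coeff (-1) = 0 := by
        have : IsAddTorsionFree A := IsAddTorsionFree.of_module_rat A
        exact (smul_eq_zero.1 h1).resolve_left (by omega)
      rw [h2, coeff_single_of_ne (Ne.symm hi), smul_zero]

theorem seriesConvTo_logTerm_map [Algebra ℚ A]
    (hcont : ∀ s : ℕ → LaurentSeries A, LSTendsToZero s → LSTendsToZero (fun i => φ (s i)))
    {g L : LaurentSeries A}
    (hL : SeriesConvTo (logTerm g) L) : SeriesConvTo (logTerm (φ g)) (φ L) := by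
  have h := hcont _ hL
  have e : ∀ m, φ (L - ∑ i ∈ Finset.range m, logTerm g i) =
      φ L - ∑ i ∈ Finset.range m, logTerm (φ g) i := fun m => by
    simp only [map_sub, map_sum, logTerm, map_rat_smul, map_pow]
  simp only [e] at h
  exact h

end Automorphism

theorem expEq_unique {B : Type*} [CommRing B] [Algebra ℚ B] {a E E' : B}
    (h : ExpEq a E) (h' : ExpEq a E') : E = E' := by
  obtain ⟨N, hN⟩ := h
  obtain ⟨N', hN'⟩ := h'
  rw [← hN (max N N') (le_max_left _ _), hN' _ (le_max_right _ _)]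

end ContouCarrere

/-- over a commutative `ℚ`-algebra `A`, the explicit one-dimensional
Contou-Carrère symbol `CC₁(1+g, f) = exp res(log(1+g)·df/f)` is invariant under continuous
`A`-algebra automorphisms `φ` of `A((t))`: note `φ(1+g) = 1 + φ(g)`, so
`log(φ(1+g))` is the logarithm series evaluated on `φ(g)`. -/
theorem stmt16 (A : Type*) [CommRing A] [Algebra ℚ A]
    (φ : LaurentSeries A →ₐ[A] LaurentSeries A)
    (hbij : Function.Bijective φ)
    (hcont : ∀ s : ℕ → LaurentSeries A, LSTendsToZero s → LSTendsToZero (fun i => φ (s i)))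
    (g : LaurentSeries A) (hunit : IsUnit (1 + g))
    (hgtop : LSTendsToZero fun i => g ^ i)
    (f : (LaurentSeries A)ˣ) :
    ∀ L L' : LaurentSeries A,
      SeriesConvTo (logTerm g) L → SeriesConvTo (logTerm (φ g)) L' →
      ∀ E E' : A,
        ExpEq ((L * lderiv (f : LaurentSeries A) *
          ((f⁻¹ : (LaurentSeries A)ˣ) : LaurentSeries A)).coeff (-1)) E →
        ExpEq ((L' * lderiv (φ (f : LaurentSeries A)) *
          φ ((f⁻¹ : (LaurentSeries A)ˣ) : LaurentSeries A)).coeff (-1)) E' →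
        E' = E := by
  intro L L' hL hL' E E' hE hE'
  obtain rfl := ContouCarrere.seriesConvTo_unique hL'
    (ContouCarrere.seriesConvTo_logTerm_map hcont hL)
  rw [ContouCarrere.lderiv_map hcont,
    show φ L * (φ (lderiv (f : LaurentSeries A)) * lderiv (φ (HahnSeries.single 1 1))) *
        φ ((f⁻¹ : (LaurentSeries A)ˣ) : LaurentSeries A) =
      φ (L * lderiv (f : LaurentSeries A) * ((f⁻¹ : (LaurentSeries A)ˣ) : LaurentSeries A)) *
        lderiv (φ (HahnSeries.single 1 1)) by simp only [map_mul]; ring,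
    ContouCarrere.coeff_neg_one_map_mul_lderiv hcont hbij.2] at hE'
  exact ContouCarrere.expEq_unique hE' hE
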